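/- arXiv:2208.04483 — 2 statements merged into one kernel-verified Lean document; each statement's English description precedes it below -/
import Mathlib

section
/- Let G be a finite non-abelian group with G = ⟨a, b⟩, where a has order at least 3 and b ≠ 1, and let m ≥ 2 be an integer. Define subsets T_{i,j} ⊆ G for i,j ∈ Z_m by: T_{i,i} = {a} for every i ∈ Z_m; T_{i,i+1} = {1} for every i ∈ Z_m with i ≠ m−1; T_{m−1,0} = {b}; and T_{i,j} = ∅ otherwise. Let Γ_m = Cay(G, T_{i,j} : i,j ∈ Z_m) be the corresponding m-Cayley digraph, and for i ∈ Z_m let G_i = {(g,i) : g ∈ G} denote the i-th block of vertices. Then every automorphism of Γ_m fixes each block G_i setwise, i.e., for every automorphism σ of Γ_m and every i ∈ Z_m, σ(G_i) = G_i. -/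
/-- The arc relation of the `m`-Cayley digraph `Cay(G, T_{i,j} : i,j ∈ Z_m)`:
there is an arc from `(g,i)` to `(t*g, j)` for each `t ∈ T i j`. -/
def mCayleyArc {G : Type*} [Group G] {m : ℕ} (T : ZMod m → ZMod m → Set G) :
    G × ZMod m → G × ZMod m → Prop :=
  fun x y => ∃ t ∈ T x.2 y.2, y.1 = t * x.1

/-- A permutation `σ` of the vertex set is an automorphism of the digraph with
arc relation `A` if it preserves the arc relation. -/
def IsDigraphAuto {V : Type*} (A : V → V → Prop) (σ : Equiv.Perm V) : Prop :=
  ∀ x y : V, A (σ x) (σ y) ↔ A x y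

/-- A digraph is oriented if there are no loops and no pair of oppositely
directed arcs between any two vertices. -/
def IsOrientedRel {V : Type*} (A : V → V → Prop) : Prop :=
  ∀ x y : V, A x y → ¬ A y x

/-- The right translation `R(h) : (g,i) ↦ (g*h, i)` on the vertex set `G × Z_m`. -/
def rightTransl {G : Type*} [Group G] (m : ℕ) (h : G) : Equiv.Perm (G × ZMod m) :=
  (Equiv.mulRight h).prodCongr (Equiv.refl (ZMod m))

/-- `G` admits an oriented `m`-semiregular representation (OmSR) of valency two:
there are connection sets `T i j ⊆ G` such that the corresponding `m`-Cayley
digraph is oriented, every vertex has exactly two out-neighbours and exactly two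
in-neighbours, and the full automorphism group consists exactly of the right
translations `R(h)`, `h ∈ G`. -/
def HasOmSRValencyTwo (G : Type*) [Group G] (m : ℕ) : Prop :=
  ∃ T : ZMod m → ZMod m → Set G,
    IsOrientedRel (mCayleyArc T) ∧
    (∀ x : G × ZMod m, {y | mCayleyArc T x y}.ncard = 2) ∧
    (∀ x : G × ZMod m, {y | mCayleyArc T y x}.ncard = 2) ∧
    (∀ σ : Equiv.Perm (G × ZMod m),
      IsDigraphAuto (mCayleyArc T) σ ↔ ∃ h : G, σ = rightTransl m h)

theorem commute_of_closure_pair_eq_top {G : Type*} [Group G] {a b : G}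
    (hgen : Subgroup.closure {a, b} = ⊤) (hab : a * b = b * a) (x y : G) : x * y = y * x := by
  have h : ∀ u ∈ ({a, b} : Set G), ∀ v ∈ ({a, b} : Set G), u * v = v * u := by
    rintro u (rfl | rfl) v (rfl | rfl) <;> simp_all
  have := Subgroup.isMulCommutative_closure h
  have hx : x ∈ Subgroup.closure {a, b} := hgen ▸ Subgroup.mem_top x
  have hy : y ∈ Subgroup.closure {a, b} := hgen ▸ Subgroup.mem_top y
  exact congrArg Subtype.val
    (mul_comm' (⟨x, hx⟩ : Subgroup.closure {a, b}) ⟨y, hy⟩)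

theorem IsDigraphAuto.symm {V : Type*} {A : V → V → Prop} {σ : Equiv.Perm V}
    (h : IsDigraphAuto A σ) : IsDigraphAuto A σ.symm := fun x y => by
  simpa using (h (σ.symm x) (σ.symm y)).symm

/-- Two distinct out-neighbours of `x` have a common out-neighbour. -/
def HasDiamond {V : Type*} (A : V → V → Prop) (x : V) : Prop :=
  ∃ y z w, y ≠ z ∧ A x y ∧ A x z ∧ A y w ∧ A z w

theorem HasDiamond.map {V : Type*} {A : V → V → Prop} {σ : Equiv.Perm V}
    (h : IsDigraphAuto A σ) {x : V} : HasDiamond A x → HasDiamond A (σ x) := by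
  rintro ⟨y, z, w, hne, hy, hz, hyw, hzw⟩
  exact ⟨σ y, σ z, σ w, σ.injective.ne hne, (h _ _).2 hy, (h _ _).2 hz, (h _ _).2 hyw,
    (h _ _).2 hzw⟩

theorem hasDiamond_apply_iff {V : Type*} {A : V → V → Prop} {σ : Equiv.Perm V}
    (h : IsDigraphAuto A σ) (x : V) : HasDiamond A (σ x) ↔ HasDiamond A x :=
  ⟨fun hx => by simpa using hx.map h.symm, HasDiamond.map h⟩

/-- In the non-abelian construction of Lemma 3.2 (Case 2), every automorphism of
`Γ_m` fixes each block `G_i = {(g,i) : g ∈ G}` setwise. -/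
theorem nonabelian_explicit_blocks_fixed
    (G : Type*) [Group G] [Fintype G] (hna : ∃ x y : G, x * y ≠ y * x)
    (a b : G) (hgen : Subgroup.closure {a, b} = ⊤)
    (ha : 3 ≤ orderOf a) (hb : b ≠ 1)
    (m : ℕ) (hm : 2 ≤ m)
    (T : ZMod m → ZMod m → Set G)
    (hT : ∀ i j : ZMod m, T i j =
      {t | (j = i ∧ t = a) ∨
           (i ≠ ((m - 1 : ℕ) : ZMod m) ∧ j = i + 1 ∧ t = 1) ∨
           (i = ((m - 1 : ℕ) : ZMod m) ∧ j = 0 ∧ t = b)}) :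
    ∀ σ : Equiv.Perm (G × ZMod m), IsDigraphAuto (mCayleyArc T) σ →
      ∀ i : ZMod m, σ '' {x : G × ZMod m | x.2 = i} = {x : G × ZMod m | x.2 = i} := by
  intro σ hσ
  have hm1 : ((m - 1 : ℕ) : ZMod m) = -1 := by
    rw [Nat.cast_sub (by lia), ZMod.natCast_self, Nat.cast_one, zero_sub]
  have : Fact (1 < m) := ⟨hm⟩
  have hab : a * b ≠ b * a := fun hab =>
    let ⟨x, y, hxy⟩ := hna
    hxy (commute_of_closure_pair_eq_top hgen hab x y)
  have arc_iff : ∀ g h : G, ∀ i j : ZMod m, mCayleyArc T (g, i) (h, j) ↔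
      (j = i ∧ h = a * g) ∨ (i ≠ -1 ∧ j = i + 1 ∧ h = g) ∨ (i = -1 ∧ j = 0 ∧ h = b * g) := by
    intro g h i j
    simp only [mCayleyArc, hT, hm1, Set.mem_ofPred_eq]
    constructor
    · rintro ⟨t, ⟨h1, rfl⟩ | ⟨h1, h2, rfl⟩ | ⟨h1, h2, rfl⟩, rfl⟩ <;> simp_all
    · rintro (⟨h1, rfl⟩ | ⟨h1, h2, rfl⟩ | ⟨h1, h2, rfl⟩)
      · exact ⟨a, .inl ⟨h1, rfl⟩, rfl⟩
      · exact ⟨1, .inr (.inl ⟨h1, h2, rfl⟩), (one_mul _).symm⟩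
      · exact ⟨b, .inr (.inr ⟨h1, h2, rfl⟩), rfl⟩
  have h01 : (0 : ZMod m) ≠ -1 := fun h => one_ne_zero (neg_eq_zero.1 h.symm)
  have no_common : ∀ (g : G) (w : G × ZMod m), mCayleyArc T (a * g, -1) w →
      ¬ mCayleyArc T (b * g, 0) w := by
    rintro g ⟨h, j⟩ h1 h2
    rw [arc_iff] at h1 h2
    rcases h1 with ⟨rfl, rfl⟩ | ⟨h1, -⟩ | ⟨-, rfl, rfl⟩
    · rcases h2 with ⟨h2, -⟩ | ⟨-, -, h2⟩ | ⟨h2, -⟩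
      · exact h01 h2.symm
      · have h3 : a * a = b := by
          rw [← mul_assoc] at h2
          exact mul_right_cancel h2
        exact hab (by rw [← h3, mul_assoc])
      · exact h01 h2
    · exact h1 rfl
    · rcases h2 with ⟨-, h2⟩ | ⟨-, h2, -⟩ | ⟨h2, -⟩
      · rw [← mul_assoc, ← mul_assoc] at h2
        exact hab (mul_right_cancel h2).symm
      · simp at h2
      · exact h01 h2
  have diamond_iff : ∀ x : G × ZMod m, HasDiamond (mCayleyArc T) x ↔ x.2 ≠ -1 := by
    rintro ⟨g, i⟩
    constructor
    · rintro ⟨⟨y, j⟩, ⟨z, k⟩, w, hne, hy, hz, hyw, hzw⟩ (rfl : i = -1)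
      rw [arc_iff] at hy hz
      rcases hy with ⟨rfl, rfl⟩ | ⟨h1, -⟩ | ⟨-, rfl, rfl⟩
      · rcases hz with ⟨rfl, rfl⟩ | ⟨h1, -⟩ | ⟨-, rfl, rfl⟩
        · exact hne rfl
        · exact h1 rfl
        · exact no_common g w hyw hzw
      · exact h1 rfl
      · rcases hz with ⟨rfl, rfl⟩ | ⟨h1, -⟩ | ⟨-, rfl, rfl⟩
        · exact no_common g w hzw hyw
        · exact h1 rfl
        · exact hne rfl
    · intro hi
      refine ⟨(a * g, i), (g, i + 1), (a * g, i + 1), by simp, ?_, ?_, ?_, ?_⟩ <;>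
        simp [arc_iff, show i ≠ -1 from hi]
  have block_iff : ∀ (i : ZMod m) (x : G × ZMod m),
      x.2 = i ↔ x.2 ≠ i + 1 ∧ ∃ y, y.2 = i + 1 ∧ mCayleyArc T x y := by
    rintro i ⟨g, j⟩
    constructor
    · rintro rfl
      refine ⟨by simp, ?_⟩
      by_cases hj : j = -1
      · exact ⟨(b * g, j + 1), rfl, by simp [arc_iff, hj]⟩
      · exact ⟨(g, j + 1), rfl, by simp [arc_iff, hj]⟩
    · rintro ⟨hj, ⟨h, k⟩, rfl : k = i + 1, harc⟩
      rcases (arc_iff _ _ _ _).1 harc with ⟨h1, -⟩ | ⟨-, h1, -⟩ | ⟨rfl, h1, -⟩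
      · exact absurd h1.symm hj
      · exact (add_right_cancel h1).symm
      · exact (eq_neg_of_add_eq_zero_left h1).symm
  have key : ∀ (n : ℕ) (x : G × ZMod m), (σ x).2 = -1 - (n : ZMod m) ↔ x.2 = -1 - (n : ZMod m) := by
    intro n
    induction n with
    | zero =>
      intro x
      rw [Nat.cast_zero, sub_zero, ← not_iff_not]
      exact (diamond_iff _).symm.trans ((hasDiamond_apply_iff hσ x).trans (diamond_iff x))
    | succ n ih =>
      intro x
      have hn : (-1 - ((n + 1 : ℕ) : ZMod m)) + 1 = -1 - (n : ZMod m) := by push_cast; ring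
      rw [block_iff, block_iff _ x, hn]
      refine and_congr (not_congr (ih x)) ⟨?_, ?_⟩
      · rintro ⟨y, hy, hxy⟩
        refine ⟨σ.symm y, (ih _).1 (by simpa using hy), (hσ _ _).1 (by simpa using hxy)⟩
      · rintro ⟨y, hy, hxy⟩
        exact ⟨σ y, (ih y).2 hy, (hσ _ _).2 hxy⟩
  intro i
  have hi : ∀ x : G × ZMod m, (σ x).2 = i ↔ x.2 = i := by
    have : NeZero m := ⟨by lia⟩
    have h := key (-1 - i).val
    rwa [ZMod.natCast_rightInverse, sub_sub_cancel] at h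
  ext x
  simp only [Equiv.image_eq_preimage_symm, Set.mem_preimage, Set.mem_ofPred_eq]
  rw [← hi, Equiv.apply_symm_apply]
end

section
/- Let G be a finite cyclic group generated by an element a of order at least 3, and let m ≥ 3 be an integer. Define subsets T_{i,j} ⊆ G for i,j ∈ Z_m by: T_{0,0} = {a}; T_{i,i} = {a^{-1}} for every i ∈ Z_m with i ≠ 0; T_{i,i+1} = {1} for every i ∈ Z_m with i ≠ m−1; T_{m−1,0} = {a}; and T_{i,j} = ∅ otherwise. Let Γ_m = Cay(G, T_{i,j} : i,j ∈ Z_m) be the corresponding m-Cayley digraph, and for i ∈ Z_m let G_i = {(g,i) : g ∈ G} denote the i-th block of vertices. Then every automorphism of Γ_m fixes each block G_i setwise, i.e., for every automorphism σ of Γ_m and every i ∈ Z_m, σ(G_i) = G_i. -/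
/-- A vertex is the apex of a commuting square if two distinct out-neighbours of it share an
out-neighbour. -/
def IsSquareApex {V : Type*} (A : V → V → Prop) (x : V) : Prop :=
  ∃ y z w, y ≠ z ∧ A x y ∧ A x z ∧ A y w ∧ A z w

theorem IsDigraphAuto.isSquareApex_iff {V : Type*} {A : V → V → Prop} {σ : Equiv.Perm V}
    (h : IsDigraphAuto A σ) (x : V) : IsSquareApex A (σ x) ↔ IsSquareApex A x := by
  constructor
  · rintro ⟨y, z, w, hne, hy, hz, hyw, hzw⟩
    obtain ⟨y, rfl⟩ := σ.surjective y
    obtain ⟨z, rfl⟩ := σ.surjective z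
    obtain ⟨w, rfl⟩ := σ.surjective w
    simp only [h _ _] at hy hz hyw hzw
    exact ⟨y, z, w, ne_of_apply_ne σ hne, hy, hz, hyw, hzw⟩
  · rintro ⟨y, z, w, hne, hy, hz, hyw, hzw⟩
    exact ⟨σ y, σ z, σ w, σ.injective.ne hne, (h _ _).2 hy, (h _ _).2 hz, (h _ _).2 hyw,
      (h _ _).2 hzw⟩

/-- An `m`-Cayley digraph in which `(g, i)` has out-neighbours `(u i * g, i)` and
`(v i * g, i + 1)`. -/
def cyclicBlockArc {G : Type*} [Group G] {m : ℕ} (u v : ZMod m → G) (x y : G × ZMod m) : Prop :=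
  (y.2 = x.2 ∧ y.1 = u x.2 * x.1) ∨ (y.2 = x.2 + 1 ∧ y.1 = v x.2 * x.1)

theorem cyclicBlockArc_isSquareApex_iff {G : Type*} [Group G] {m : ℕ}
    (h1 : (1 : ZMod m) ≠ 0) (h2 : (1 + 1 : ZMod m) ≠ 0) (u v : ZMod m → G) (x : G × ZMod m) :
    IsSquareApex (cyclicBlockArc u v) x ↔ v x.2 * u x.2 = u (x.2 + 1) * v x.2 := by
  obtain ⟨g, i⟩ := x
  constructor
  · rintro ⟨y, z, w, hne, hy, hz, hyw, hzw⟩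
    have mixed {y z : G × ZMod m} (hy : y.2 = i ∧ y.1 = u i * g)
        (hz : z.2 = i + 1 ∧ z.1 = v i * g) (hyw : cyclicBlockArc u v y w)
        (hzw : cyclicBlockArc u v z w) : v i * u i = u (i + 1) * v i := by
      simp only [cyclicBlockArc, hy, hz, add_assoc] at hyw hzw
      rcases hyw with ⟨hj, hw⟩ | ⟨hj, hw⟩ <;> rcases hzw with ⟨hj', hw'⟩ | ⟨hj', hw'⟩
      · exact absurd (hj.symm.trans hj') (by simp [h1])
      · exact absurd (hj.symm.trans hj') (by simp [h2])
      · simpa [← mul_assoc] using hw.symm.trans hw'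
      · exact absurd (hj.symm.trans hj') (by simp [h1])
    rcases hy with hy | hy <;> rcases hz with hz | hz
    · exact absurd (Prod.ext (hy.2.trans hz.2.symm) (hy.1.trans hz.1.symm)) hne
    · exact mixed hy hz hyw hzw
    · exact mixed hz hy hzw hyw
    · exact absurd (Prod.ext (hy.2.trans hz.2.symm) (hy.1.trans hz.1.symm)) hne
  · intro h
    refine ⟨(u i * g, i), (v i * g, i + 1), (v i * (u i * g), i + 1), ?_, ?_⟩
    · simp [h1]
    · simp [cyclicBlockArc, ← mul_assoc, show v i * u i = u (i + 1) * v i from h]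

/-- If an automorphism preserves the block `0`, it preserves every block. -/
theorem cyclicBlockArc_auto_snd_eq {G : Type*} [Group G] {m : ℕ} [NeZero m]
    (h1 : (1 : ZMod m) ≠ 0) {u v : ZMod m → G} {σ : Equiv.Perm (G × ZMod m)}
    (hσ : IsDigraphAuto (cyclicBlockArc u v) σ) (h0 : ∀ x, (σ x).2 = 0 ↔ x.2 = 0)
    (i : ZMod m) (x : G × ZMod m) : (σ x).2 = i ↔ x.2 = i := by
  have next (i : ZMod m) (x : G × ZMod m) :
      x.2 = i + 1 ↔ x.2 ≠ i ∧ ∃ y : G × ZMod m, y.2 = i ∧ cyclicBlockArc u v y x := by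
    constructor
    · intro hx
      exact ⟨by simp [hx, h1], ((v i)⁻¹ * x.1, i), rfl, Or.inr ⟨hx, by simp⟩⟩
    · rintro ⟨hx, y, rfl, h | h⟩
      exacts [absurd h.1 hx, h.1]
  have key (n : ℕ) : ∀ x, (σ x).2 = (n : ZMod m) ↔ x.2 = (n : ZMod m) := by
    induction n with
    | zero => simpa using h0
    | succ n ih =>
      intro x
      rw [Nat.cast_succ, next, next, σ.surjective.exists]
      simp only [ne_eq, ih, hσ _ _]
  simpa using key i.val x

/-- In the cyclic construction of Lemma 3.1 with `m ≥ 3`, every automorphism of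
`Γ_m` fixes each block `G_i = {(g,i) : g ∈ G}` setwise. -/
theorem cyclic_explicit_blocks_fixed
    (G : Type*) [Group G] [Fintype G] (a : G)
    (hgen : Subgroup.zpowers a = ⊤) (ha : 3 ≤ orderOf a)
    (m : ℕ) (hm : 3 ≤ m)
    (T : ZMod m → ZMod m → Set G)
    (hT : ∀ i j : ZMod m, T i j =
      {t | (i = 0 ∧ j = 0 ∧ t = a) ∨
           (i ≠ 0 ∧ j = i ∧ t = a⁻¹) ∨
           (i ≠ ((m - 1 : ℕ) : ZMod m) ∧ j = i + 1 ∧ t = 1) ∨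
           (i = ((m - 1 : ℕ) : ZMod m) ∧ j = 0 ∧ t = a)}) :
    ∀ σ : Equiv.Perm (G × ZMod m), IsDigraphAuto (mCayleyArc T) σ →
      ∀ i : ZMod m, σ '' {x : G × ZMod m | x.2 = i} = {x : G × ZMod m | x.2 = i} := by
  intro σ hσ
  have hm' : NeZero m := ⟨by omega⟩
  have h1 : (1 : ZMod m) ≠ 0 := by
    have : Fact (1 < m) := ⟨by omega⟩
    exact one_ne_zero
  have h2 : (1 + 1 : ZMod m) ≠ 0 := by
    intro h
    have h' : ((2 : ℕ) : ZMod m) = 0 := by push_cast; rw [← one_add_one_eq_two]; exact h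
    have := Nat.le_of_dvd (by omega) ((ZMod.natCast_eq_zero_iff 2 m).1 h')
    omega
  have hlast (i : ZMod m) : i = ((m - 1 : ℕ) : ZMod m) ↔ i + 1 = 0 := by
    rw [Nat.cast_sub (by omega)]
    simp [eq_neg_iff_add_eq_zero]
  have haa : a * a ≠ 1 := by
    intro h
    have := Nat.le_of_dvd (by omega) (orderOf_dvd_of_pow_eq_one ((pow_two a).trans h))
    omega
  have hinv : a⁻¹ ≠ a := fun h => haa (inv_eq_iff_mul_eq_one.1 h)
  classical
  set u : ZMod m → G := fun i => if i = 0 then a else a⁻¹ with hu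
  set v : ZMod m → G := fun i => if i + 1 = 0 then a else 1 with hv
  have harc : mCayleyArc T = cyclicBlockArc u v := by
    ext ⟨g, i⟩ ⟨h, j⟩
    simp only [mCayleyArc, cyclicBlockArc, hT, hlast, Set.mem_ofPred_eq, hu, hv]
    by_cases hi : i = 0 <;> by_cases hi' : i + 1 = 0 <;> aesop
  rw [harc] at hσ
  have hapex (x : G × ZMod m) :
      IsSquareApex (cyclicBlockArc u v) x ↔ x.2 ≠ 0 ∧ x.2 + 1 ≠ 0 := by
    rw [cyclicBlockArc_isSquareApex_iff h1 h2]
    by_cases hi : x.2 = 0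
    · simp [hu, hv, hi, h1, hinv.symm]
    · by_cases hi' : x.2 + 1 = 0
      · simp [hu, hv, hi, hi', haa.symm]
      · simp [hu, hv, hi, hi']
  have hzero (x : G × ZMod m) : x.2 = 0 ↔ ¬ IsSquareApex (cyclicBlockArc u v) x ∧
      ∃ y, cyclicBlockArc u v x y ∧ IsSquareApex (cyclicBlockArc u v) y := by
    simp only [hapex]
    constructor
    · intro hx
      exact ⟨by simp [hx], (v x.2 * x.1, x.2 + 1), Or.inr ⟨rfl, rfl⟩, by simp [hx, h1, h2]⟩
    · rintro ⟨hx, y, h | h, hy⟩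
      · exact absurd (h.1 ▸ hy) hx
      · by_contra h0
        exact hx ⟨h0, h.1 ▸ hy.1⟩
  have h0 (x : G × ZMod m) : (σ x).2 = 0 ↔ x.2 = 0 := by
    rw [hzero, hzero, σ.surjective.exists]
    simp only [hσ.isSquareApex_iff, hσ _ _]
  intro i
  rw [Equiv.image_eq_preimage_symm]
  ext x
  simpa using (cyclicBlockArc_auto_snd_eq h1 hσ h0 i (σ.symm x)).symm
end
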